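/- If B₁ and B₂ are normal crystals, then their Kashiwara tensor product B₁ ⊗ B₂ is a normal crystal: for every b₁⊗b₂, ε_i(b₁⊗b₂) = max{n : e_iⁿ·(b₁⊗b₂) ≠ 0} and φ_i(b₁⊗b₂) = max{n : f_iⁿ·(b₁⊗b₂) ≠ 0}. -/

import Mathlib

namespace CrystalPaper

/-- A pre-crystal: the raw data of a crystal for index set `I` and weight lattice `Λ`. -/
structure PreCrystal (I Λ : Type) [AddCommGroup Λ] where
  B : Type
  wt : B → Λ
  eps : B → I → ℤ
  phi : B → I → ℤ
  e : I → B → Option B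
  f : I → B → Option B

variable {I Λ : Type} [AddCommGroup Λ]

/-- Iterate a partial map `n` times. -/
def iterOpt {β : Type} (g : β → Option β) : ℕ → β → Option β
  | 0, b => some b
  | n + 1, b => (g b).bind (iterOpt g n)

/-- The crystal axioms (A), (B), (C), relative to the simple roots `sr i = αᵢ`
and the pairing `pair μ i = ⟨μ, αᵢ^∨⟩`. -/
def IsCrystal (sr : I → Λ) (pair : Λ → I → ℤ) (C : PreCrystal I Λ) : Prop :=
  (∀ b i, C.phi b i = C.eps b i + pair (C.wt b) i) ∧
  (∀ i b b', C.e i b = some b' →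
      C.wt b' = C.wt b + sr i ∧ C.eps b' i = C.eps b i - 1 ∧ C.phi b' i = C.phi b i + 1) ∧
  (∀ i b b', C.f i b = some b' →
      C.wt b' = C.wt b - sr i ∧ C.eps b' i = C.eps b i + 1 ∧ C.phi b' i = C.phi b i - 1) ∧
  (∀ i b b', C.e i b = some b' ↔ C.f i b' = some b)

/-- Normality: `εᵢ(b) = max {n | eᵢⁿ b ≠ 0}` and `φᵢ(b) = max {n | fᵢⁿ b ≠ 0}`. -/
def IsNormal (C : PreCrystal I Λ) : Prop :=
  ∀ b i,
    (0 ≤ C.eps b i ∧ iterOpt (C.e i) (C.eps b i).toNat b ≠ none ∧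
      iterOpt (C.e i) ((C.eps b i).toNat + 1) b = none) ∧
    (0 ≤ C.phi b i ∧ iterOpt (C.f i) (C.phi b i).toNat b ≠ none ∧
      iterOpt (C.f i) ((C.phi b i).toNat + 1) b = none)

/-- Kashiwara's tensor product of (pre-)crystals. -/
@[reducible] def tensor (C D : PreCrystal I Λ) : PreCrystal I Λ where
  B := C.B × D.B
  wt p := C.wt p.1 + D.wt p.2
  eps p i := max (D.eps p.2 i) (C.eps p.1 i - D.phi p.2 i + D.eps p.2 i)
  phi p i := max (C.phi p.1 i) (D.phi p.2 i - C.eps p.1 i + C.phi p.1 i)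
  e i p :=
    if C.eps p.1 i > D.phi p.2 i then (C.e i p.1).map fun b => (b, p.2)
    else (D.e i p.2).map fun b => (p.1, b)
  f i p :=
    if C.eps p.1 i ≥ D.phi p.2 i then (C.f i p.1).map fun b => (b, p.2)
    else (D.f i p.2).map fun b => (p.1, b)

/-- `B` is generated from `b0` by the operators `fᵢ`. -/
def GeneratedByF (C : PreCrystal I Λ) (b0 : C.B) : Prop :=
  ∀ b : C.B, ∃ w : List I,
    List.foldl (fun (ob : Option C.B) i => ob.bind (C.f i)) (some b0) w = some b

/-- `b0` is a highest weight element of weight `lam` generating `C`. -/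
def IsHighestWeight (C : PreCrystal I Λ) (lam : Λ) (b0 : C.B) : Prop :=
  C.wt b0 = lam ∧ (∀ i, C.e i b0 = none) ∧ GeneratedByF C b0

/-- Dominance order: `μ ≤ lam` iff `lam - μ` is a nonnegative integer
combination of the simple roots. -/
def DomLE (sr : I → Λ) (μ lam : Λ) : Prop :=
  ∃ c : I →₀ ℕ, lam - μ = c.sum fun i n => (n : ℤ) • sr i

/-- Connectedness under the partial operators `eᵢ`, `fᵢ`. -/
def Connected (C : PreCrystal I Λ) : C.B → C.B → Prop :=
  Relation.ReflTransGen fun a b => ∃ i, C.e i a = some b ∨ C.f i a = some b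

end CrystalPaper

namespace CrystalPaper

/-- Iterating a partial map which lowers a nonnegative integer statistic by one and is
undefined only where the statistic vanishes. -/
theorem iterOpt_stat {β : Type} (g : β → Option β) (m : β → ℤ) (h0 : ∀ b, 0 ≤ m b)
    (hs : ∀ b b', g b = some b' → m b' = m b - 1) (hn : ∀ b, g b = none → m b = 0)
    (b : β) : 0 ≤ m b ∧ iterOpt g (m b).toNat b ≠ none ∧
      iterOpt g ((m b).toNat + 1) b = none := by
  refine ⟨h0 b, ?_⟩
  generalize hk : (m b).toNat = k
  induction k generalizing b with
  | zero =>
    refine ⟨by simp [iterOpt], ?_⟩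
    cases hg : g b with
    | none => simp [iterOpt, hg]
    | some b' =>
      have h1 := hs b b' hg
      have h2 := h0 b'
      have h3 := h0 b
      omega
  | succ k ih =>
    cases hg : g b with
    | none =>
      have h1 := hn b hg
      omega
    | some b' =>
      have h1 := hs b b' hg
      obtain ⟨i1, i2⟩ := ih b' (by omega)
      rw [iterOpt, iterOpt, hg]
      exact ⟨i1, i2⟩

theorem stat_eq_zero {β : Type} (g : β → Option β) (n : ℤ) (b : β) (h0 : 0 ≤ n)
    (hi : iterOpt g n.toNat b ≠ none) (hg : g b = none) : n = 0 := by
  generalize hk : n.toNat = k at hi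
  cases k with
  | zero => omega
  | succ k => simp [iterOpt, hg] at hi

end CrystalPaper

open CrystalPaper in
/-- the Kashiwara tensor product of two normal crystals is normal. -/
theorem tensor_isNormal {I Λ : Type} [AddCommGroup Λ] (sr : I → Λ) (pair : Λ → I → ℤ)
    (C D : PreCrystal I Λ)
    (hC : IsCrystal sr pair C) (hD : IsCrystal sr pair D)
    (hCn : IsNormal C) (hDn : IsNormal D) :
    IsNormal (tensor C D) := by
  obtain ⟨-, hCe, hCf, -⟩ := hC
  obtain ⟨-, hDe, hDf, -⟩ := hD
  intro b i
  have c1 := fun x => (hCn x i).1.1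
  have c2 := fun x => (hCn x i).2.1
  have d1 := fun x => (hDn x i).1.1
  have d2 := fun x => (hDn x i).2.1
  have cz1 := fun x => stat_eq_zero (C.e i) _ x (c1 x) (hCn x i).1.2.1
  have cz2 := fun x => stat_eq_zero (C.f i) _ x (c2 x) (hCn x i).2.2.1
  have dz1 := fun x => stat_eq_zero (D.e i) _ x (d1 x) (hDn x i).1.2.1
  have dz2 := fun x => stat_eq_zero (D.f i) _ x (d2 x) (hDn x i).2.2.1
  constructor
  · refine iterOpt_stat ((tensor C D).e i) (fun p => (tensor C D).eps p i) ?_ ?_ ?_ b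
    · rintro ⟨x, y⟩
      have := d1 y
      simp only
      omega
    · rintro ⟨x, y⟩ b' h
      simp only at h ⊢
      split_ifs at h with hc
      · obtain ⟨z, hz, rfl⟩ := Option.map_eq_some_iff.1 h
        have := hCe i x z hz
        simp only
        omega
      · obtain ⟨z, hz, rfl⟩ := Option.map_eq_some_iff.1 h
        have := hDe i y z hz
        simp only
        omega
    · rintro ⟨x, y⟩ h
      simp only at h ⊢
      have := d2 y
      split_ifs at h with hc
      · have := cz1 x (Option.map_eq_none_iff.1 h)
        omega
      · have := dz1 y (Option.map_eq_none_iff.1 h)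
        omega
  · refine iterOpt_stat ((tensor C D).f i) (fun p => (tensor C D).phi p i) ?_ ?_ ?_ b
    · rintro ⟨x, y⟩
      have := c2 x
      simp only
      omega
    · rintro ⟨x, y⟩ b' h
      simp only at h ⊢
      split_ifs at h with hc
      · obtain ⟨z, hz, rfl⟩ := Option.map_eq_some_iff.1 h
        have := hCf i x z hz
        simp only
        omega
      · obtain ⟨z, hz, rfl⟩ := Option.map_eq_some_iff.1 h
        have := hDf i y z hz
        simp only
        omega
    · rintro ⟨x, y⟩ h
      simp only at h ⊢
      have := c1 x
      split_ifs at h with hc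
      · have := cz2 x (Option.map_eq_none_iff.1 h)
        omega
      · have := dz2 y (Option.map_eq_none_iff.1 h)
        omega
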